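/- Let g : ℝ^q → ℝ be differentiable, strongly convex with parameter κ > 0 (i.e., ⟨∇g(a) − ∇g(b), a − b⟩ ≥ κ‖a − b‖² for all a, b), and have L-Lipschitz gradient with κ ≤ L. Fix z⋆ ∈ ℝ^q and define Φ(z) = ∇g(z + z⋆) − ∇g(z⋆). Then Φ(0) = 0 and Φ lies in the sector [κ, L]: for every z ∈ ℝ^q, ⟨Φ(z) − κ z, L z − Φ(z)⟩ ≥ 0. -/

import Mathlib

open RealInnerProductSpace

section

variable {E : Type*} [NormedAddCommGroup E] [InnerProductSpace ℝ E] [CompleteSpace E]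

/-- Quadratic upper bound for a function whose gradient `G` satisfies
`⟪G a - G b, a - b⟫ ≤ M * ‖a - b‖ ^ 2`; the constant `M` may have any sign. -/
theorem le_quadratic_of_inner_gradient_sub_le {f : E → ℝ} {G : E → E} {M : ℝ}
    (hf : ∀ x, HasGradientAt f (G x) x)
    (hG : ∀ a b, ⟪G a - G b, a - b⟫ ≤ M * ‖a - b‖ ^ 2) (x v : E) :
    f (x + v) ≤ f x + ⟪G x, v⟫ + M / 2 * ‖v‖ ^ 2 := by
  have hderiv : ∀ t : ℝ, HasDerivAt
      (fun t : ℝ => f (x + t • v) - t * ⟪G x, v⟫ - M / 2 * ‖v‖ ^ 2 * t ^ 2)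
      (⟪G (x + t • v), v⟫ - ⟪G x, v⟫ - M * ‖v‖ ^ 2 * t) t := by
    intro t
    have hline : HasDerivAt (fun t : ℝ => x + t • v) v t := by
      simpa using ((hasDerivAt_id t).smul_const v).const_add x
    have hcomp : HasDerivAt (fun t : ℝ => f (x + t • v)) ⟪G (x + t • v), v⟫ t := by
      simpa [Function.comp_def] using
        (hf (x + t • v)).hasFDerivAt.comp_hasDerivAt t hline
    have hlin : HasDerivAt (fun t : ℝ => t * ⟪G x, v⟫) ⟪G x, v⟫ t := by
      simpa using (hasDerivAt_id t).mul_const ⟪G x, v⟫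
    refine ((hcomp.sub hlin).sub
      ((hasDerivAt_pow 2 t).const_mul (M / 2 * ‖v‖ ^ 2))).congr_deriv ?_
    norm_num
    ring
  have hanti : AntitoneOn
      (fun t : ℝ => f (x + t • v) - t * ⟪G x, v⟫ - M / 2 * ‖v‖ ^ 2 * t ^ 2)
      (Set.Icc 0 1) := by
    refine antitoneOn_of_hasDerivWithinAt_nonpos (convex_Icc 0 1)
      (fun t _ => (hderiv t).continuousAt.continuousWithinAt)
      (fun t _ => (hderiv t).hasDerivWithinAt) fun t ht => ?_
    rw [interior_Icc] at ht
    have h := hG (x + t • v) x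
    rw [add_sub_cancel_left, inner_smul_right, inner_sub_left, norm_smul, mul_pow,
      Real.norm_eq_abs, sq_abs] at h
    refine nonpos_of_mul_nonpos_right ?_ ht.1
    linarith
  have h := hanti (Set.left_mem_Icc.2 zero_le_one) (Set.right_mem_Icc.2 zero_le_one) zero_le_one
  simp only [one_smul, zero_smul, add_zero] at h
  linarith

/-- A gradient that is `κ`-strongly monotone and satisfies the one-sided bound
`⟪G a - G b, a - b⟫ ≤ L * ‖a - b‖ ^ 2` is incrementally in the sector `[κ, L]`. -/
theorem inner_gradient_sub_sector {f : E → ℝ} {G : E → E} {κ L : ℝ} (hκL : κ ≤ L)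
    (hf : ∀ x, HasGradientAt f (G x) x)
    (hlower : ∀ a b, κ * ‖a - b‖ ^ 2 ≤ ⟪G a - G b, a - b⟫)
    (hupper : ∀ a b, ⟪G a - G b, a - b⟫ ≤ L * ‖a - b‖ ^ 2) (a b : E) :
    0 ≤ ⟪(G a - G b) - κ • (a - b), L • (a - b) - (G a - G b)⟫ := by
  have hup := le_quadratic_of_inner_gradient_sub_le hf hupper
  have hlow : ∀ x v, f x + ⟪G x, v⟫ + κ / 2 * ‖v‖ ^ 2 ≤ f (x + v) := by
    intro x v
    have hneg : ∀ y, HasGradientAt (fun y => -f y) (-G y) y := fun y => by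
      rw [hasGradientAt_iff_hasFDerivAt, map_neg]
      exact (hf y).hasFDerivAt.neg
    have h := le_quadratic_of_inner_gradient_sub_le (M := -κ) hneg (fun a b => by
      have h := hlower a b
      rw [← neg_sub', inner_neg_left]
      linarith) x v
    rw [inner_neg_left] at h
    linarith
  obtain ⟨d, hd⟩ : ∃ d, d = (G a - G b) - κ • (a - b) := ⟨_, rfl⟩
  obtain ⟨w, hw⟩ : ∃ w, w = a - b := ⟨_, rfl⟩
  have hGa : G a = G b + d + κ • w := by rw [hd, hw]; abel
  have ha : a = b + w := by rw [hw]; abel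
  have key : ∀ t : ℝ, (2 * t - (L - κ) * t ^ 2) * ‖d‖ ^ 2 ≤ ⟪d, w⟫ := by
    intro t
    have h1 := hlow a (t • d - w)
    have h2 := hup b (t • d)
    have h3 := hlow b (w - t • d)
    have h4 := hup a (-(t • d))
    rw [show a + (t • d - w) = b + t • d by rw [ha]; abel] at h1
    rw [show b + (w - t • d) = a + -(t • d) by rw [ha]; abel] at h3
    rw [hGa] at h1 h4
    rw [norm_sub_sq_real] at h1 h3
    simp only [inner_add_left, inner_sub_right, inner_neg_right, inner_smul_left,
      inner_smul_right, norm_neg, norm_smul, mul_pow, Real.norm_eq_abs, sq_abs,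
      real_inner_self_eq_norm_sq, conj_trivial, real_inner_comm d w] at h1 h2 h3 h4
    linarith
  have hcoco : ‖d‖ ^ 2 ≤ (L - κ) * ⟪d, w⟫ := by
    rcases hκL.eq_or_lt with rfl | hlt
    · have h1 := key 1
      have h2 := hupper a b
      have h3 : ⟪d, w⟫ ≤ 0 := by
        rw [hd, hw, inner_sub_left, real_inner_smul_left, real_inner_self_eq_norm_sq]
        linarith
      linarith
    · have hM : 0 < L - κ := sub_pos.2 hlt
      have h := mul_le_mul_of_nonneg_left (key (L - κ)⁻¹) hM.le
      have h' : (L - κ) * ((2 * (L - κ)⁻¹ - (L - κ) * (L - κ)⁻¹ ^ 2) * ‖d‖ ^ 2) = ‖d‖ ^ 2 := by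
        field_simp
        ring
      linarith
  have hsplit : L • (a - b) - (G a - G b) = (L - κ) • w - d := by
    rw [hd, hw, sub_smul]; abel
  rw [hsplit, ← hd, inner_sub_right, real_inner_smul_right, real_inner_self_eq_norm_sq]
  linarith

end

/-- If `g` is differentiable, strongly convex with parameter `κ > 0`, and has an
`L`-Lipschitz gradient with `κ ≤ L`, then the shifted operator
`Φ(z) = ∇g(z + z⋆) − ∇g(z⋆)` satisfies `Φ(0) = 0` and lies in the sector `[κ, L]`. -/
theorem stmt_10 {q : ℕ} (g : EuclideanSpace ℝ (Fin q) → ℝ)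
    (hdiff : Differentiable ℝ g) (κ L : ℝ) (hκ : 0 < κ) (hκL : κ ≤ L)
    (hstrong : ∀ a b : EuclideanSpace ℝ (Fin q),
      ⟪gradient g a - gradient g b, a - b⟫ ≥ κ * ‖a - b‖ ^ 2)
    (hlip : ∀ a b : EuclideanSpace ℝ (Fin q),
      ‖gradient g a - gradient g b‖ ≤ L * ‖a - b‖)
    (zstar : EuclideanSpace ℝ (Fin q))
    (Φ : EuclideanSpace ℝ (Fin q) → EuclideanSpace ℝ (Fin q))
    (hΦ : ∀ z, Φ z = gradient g (z + zstar) - gradient g zstar) :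
    Φ 0 = 0 ∧ ∀ z : EuclideanSpace ℝ (Fin q), ⟪Φ z - κ • z, L • z - Φ z⟫ ≥ 0 := by
  refine ⟨by simp [hΦ], fun z => ?_⟩
  have h := inner_gradient_sub_sector hκL (fun x => (hdiff x).hasGradientAt) hstrong
    (fun a b => (real_inner_le_norm _ _).trans <| by
      rw [pow_two, ← mul_assoc]
      exact mul_le_mul_of_nonneg_right (hlip a b) (norm_nonneg _)) (z + zstar) zstar
  rw [add_sub_cancel_right, ← hΦ] at h
  exact h
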